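/- Fix positive integers L, K, M. For every ε > 0 there exists q₀ such that for every finite field F with |F| = q ≥ q₀ the following holds: if A and B are independent random matrices, with A uniformly distributed on F^{L×K} and B uniformly distributed on F^{K×M}, then |H(AB | B)/log q − min(L·M, L·K)| < ε. -/

import Mathlib

open scoped BigOperators Classical

noncomputable section

namespace SDMM

variable {Ω : Type} [Fintype Ω]

/-- The probability that the random variable `X` (on finite sample space `Ω`
with probability mass function `p`) takes the value `a`. -/
def distOf (p : Ω → ℝ) {α : Type*} (X : Ω → α) (a : α) : ℝ :=
  ∑ ω, if X ω = a then p ω else 0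

/-- `p` is a probability mass function on `Ω`. -/
def IsPMF (p : Ω → ℝ) : Prop := (∀ ω, 0 ≤ p ω) ∧ ∑ ω, p ω = 1

/-- Shannon entropy (natural-log units) of the random variable `X`. -/
def H (p : Ω → ℝ) {α : Type*} [Fintype α] (X : Ω → α) : ℝ :=
  ∑ a, Real.negMulLog (distOf p X a)

/-- Conditional Shannon entropy `H(X | Y) = H(X, Y) - H(Y)`. -/
def Hc (p : Ω → ℝ) {α β : Type*} [Fintype α] [Fintype β] (X : Ω → α) (Y : Ω → β) : ℝ :=
  H p (fun ω => (X ω, Y ω)) - H p Y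

/-- Mutual information `I(X ; Y) = H(X) + H(Y) - H(X, Y)`. -/
def MI (p : Ω → ℝ) {α β : Type*} [Fintype α] [Fintype β] (X : Ω → α) (Y : Ω → β) : ℝ :=
  H p X + H p Y - H p (fun ω => (X ω, Y ω))

/-- Conditional mutual information `I(X ; Y | Z)`. -/
def CMI (p : Ω → ℝ) {α β γ : Type*} [Fintype α] [Fintype β] [Fintype γ]
    (X : Ω → α) (Y : Ω → β) (Z : Ω → γ) : ℝ :=
  H p (fun ω => (X ω, Z ω)) + H p (fun ω => (Y ω, Z ω))
    - H p (fun ω => (X ω, Y ω, Z ω)) - H p Z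

/-- `X` is uniformly distributed on `α`. -/
def Uniform (p : Ω → ℝ) {α : Type*} [Fintype α] (X : Ω → α) : Prop :=
  ∀ a, distOf p X a = 1 / Fintype.card α

/-- `X` and `Y` are independent random variables. -/
def IndepRV (p : Ω → ℝ) {α β : Type*} (X : Ω → α) (Y : Ω → β) : Prop :=
  ∀ a b, distOf p (fun ω => (X ω, Y ω)) (a, b) = distOf p X a * distOf p Y b

end SDMM

open Finset in
/-- The image of a uniform random element under a homomorphism of finite groups has the entropy
of the uniform distribution on the range. -/
theorem sum_negMulLog_card_fiber {G G' : Type*} [AddGroup G] [AddGroup G'] [Fintype G]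
    [Fintype G'] (f : G →+ G') :
    ∑ y, Real.negMulLog ((#{g | f g = y} : ℝ) / Fintype.card G) =
      Real.log #(univ.image f) := by
  set k := #{g | f g = 0}
  set c := #(univ.image f)
  have hk : ∀ y ∈ univ.image f, #{g | f g = y} = k := fun y hy =>
    AddMonoidHom.card_fiber_eq_of_mem_range f (by simpa using hy) ⟨0, map_zero f⟩
  have hG : Fintype.card G = c * k := by
    rw [← card_univ, card_eq_sum_card_image f, sum_congr rfl hk, sum_const, smul_eq_mul]
  have hpos : 0 < c * k := hG ▸ Fintype.card_pos
  have hc : (c : ℝ) ≠ 0 := by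
    exact_mod_cast (Nat.pos_of_mul_pos_right hpos).ne'
  have hk0 : (k : ℝ) ≠ 0 := by
    exact_mod_cast (Nat.pos_of_mul_pos_left hpos).ne'
  rw [← sum_subset (subset_univ (univ.image f))]
  · rw [sum_congr rfl fun y hy => by rw [hk y hy], sum_const, hG, nsmul_eq_mul]
    have : (k : ℝ) / ((c * k : ℕ) : ℝ) = (c : ℝ)⁻¹ := by
      push_cast
      field_simp
    rw [this, Real.negMulLog, Real.log_inv]
    change (c : ℝ) * _ = _
    field_simp
  · intro y _ hy
    have : #{g | f g = y} = 0 := by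
      rw [card_eq_zero, filter_eq_empty_iff]
      exact fun g _ hg => hy (mem_image.2 ⟨g, mem_univ g, hg⟩)
    simp [this]

open Finset in
/-- Most families of `k ≤ n` vectors of `Fⁿ` are linearly independent. -/
theorem one_sub_div_le_card_linearIndependent (F : Type*) [Field F] [Fintype F] {k n : ℕ}
    (hkn : k ≤ n) :
    (1 - k / Fintype.card F : ℝ) * Fintype.card (Fin k → Fin n → F) ≤
      #{s : Fin k → Fin n → F | LinearIndependent F s} := by
  set q := Fintype.card F
  have hq : (1 : ℝ) < q := by exact_mod_cast Fintype.one_lt_card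
  have hcard : (#{s : Fin k → Fin n → F | LinearIndependent F s} : ℝ) =
      ∏ i : Fin k, ((q : ℝ) ^ n - (q : ℝ) ^ i.val) := by
    have h := card_linearIndependent (K := F) (V := Fin n → F) (k := k) (by simpa using hkn)
    rw [Nat.card_eq_fintype_card, Fintype.card_subtype] at h
    rw [h, Nat.cast_prod]
    refine prod_congr rfl fun i _ => ?_
    rw [Module.finrank_fintype_fun_eq_card, Fintype.card_fin, Nat.cast_sub, Nat.cast_pow,
      Nat.cast_pow]
    exact Nat.pow_le_pow_right Fintype.card_pos (i.2.le.trans hkn)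
  have hbern : (1 - k / q : ℝ) ≤ (1 - 1 / q) ^ k := by
    have h := one_add_mul_le_pow (a := -(1 / q : ℝ)) (by
      have : (1 / q : ℝ) ≤ 1 := (div_le_one (by linarith)).2 hq.le
      linarith) k
    calc (1 - k / q : ℝ) = 1 + k * -(1 / q : ℝ) := by ring
      _ ≤ _ := by rwa [← sub_eq_add_neg] at h
  have hfactor : ∀ i : Fin k, (1 - 1 / q : ℝ) * (q : ℝ) ^ n ≤ (q : ℝ) ^ n - (q : ℝ) ^ i.val := by
    intro i
    obtain ⟨m, rfl⟩ : ∃ m, n = m + 1 := ⟨n - 1, by have := i.2; omega⟩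
    have : (q : ℝ) ^ i.val ≤ (q : ℝ) ^ m := pow_le_pow_right₀ hq.le (by have := i.2; omega)
    have h2 : (1 - 1 / q : ℝ) * (q : ℝ) ^ (m + 1) = (q : ℝ) ^ (m + 1) - (q : ℝ) ^ m := by
      have : (q : ℝ) ≠ 0 := by linarith
      field_simp
      ring
    linarith
  have hnonneg : (0 : ℝ) ≤ 1 - 1 / q := by
    have : (1 / q : ℝ) ≤ 1 := (div_le_one (by linarith)).2 hq.le
    linarith
  calc (1 - k / q : ℝ) * Fintype.card (Fin k → Fin n → F)
      ≤ (1 - 1 / q) ^ k * Fintype.card (Fin k → Fin n → F) := by gcongr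
    _ = ∏ _i : Fin k, ((1 - 1 / q : ℝ) * (q : ℝ) ^ n) := by
        simp [q, mul_pow]
    _ ≤ ∏ i : Fin k, ((q : ℝ) ^ n - (q : ℝ) ^ i.val) :=
        prod_le_prod (fun _ _ => by positivity) fun i _ => hfactor i
    _ = _ := hcard.symm

theorem card_matrix_fin (F : Type*) [Fintype F] (m n : ℕ) :
    Fintype.card (Matrix (Fin m) (Fin n) F) = Fintype.card F ^ (m * n) := by
  rw [Fintype.card_congr (Matrix.of (m := Fin m) (n := Fin n) (α := F)).symm]
  simp [mul_comm m n, pow_mul]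

/-- Right multiplication by a matrix with linearly independent rows is injective. -/
theorem mul_right_injective_of_linearIndependent_row {F : Type*} [Field F] {L K M : ℕ}
    {b : Matrix (Fin K) (Fin M) F} (hb : LinearIndependent F b.row) :
    Function.Injective fun a : Matrix (Fin L) (Fin K) F => a * b := by
  intro a a' h
  funext i
  apply Matrix.vecMul_injective_iff.2 hb
  exact congrFun h i

/-- Right multiplication by a matrix with linearly independent columns is surjective. -/
theorem mul_right_surjective_of_linearIndependent_col {F : Type*} [Field F] {L K M : ℕ}
    {b : Matrix (Fin K) (Fin M) F} (hb : LinearIndependent F b.col) :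
    Function.Surjective fun a : Matrix (Fin L) (Fin K) F => a * b := by
  obtain ⟨g, hg⟩ := LinearMap.exists_leftInverse_of_injective (Matrix.toLin' b)
    (LinearMap.ker_eq_bot.2 (Matrix.mulVec_injective_iff.2 hb))
  have hinv : LinearMap.toMatrix' g * b = 1 := by
    rw [← LinearMap.toMatrix'_toLin' b, ← LinearMap.toMatrix'_comp, hg, LinearMap.toMatrix'_id]
  intro c
  exact ⟨c * LinearMap.toMatrix' g, by simp [Matrix.mul_assoc, hinv]⟩

open Finset in
/-- For most `b`, right multiplication by `b` has a range of the largest possible size. -/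
theorem one_sub_div_le_card_full_range (F : Type) [Field F] [Fintype F] (L K M : ℕ) :
    (1 - (min M K : ℕ) / Fintype.card F : ℝ) * Fintype.card (Matrix (Fin K) (Fin M) F) ≤
      #{b : Matrix (Fin K) (Fin M) F |
        #(univ.image fun a : Matrix (Fin L) (Fin K) F => a * b) =
          Fintype.card F ^ (L * min M K)} := by
  rcases le_total K M with h | h
  · rw [min_eq_right h]
    have hcard : Fintype.card (Matrix (Fin K) (Fin M) F) = Fintype.card (Fin K → Fin M → F) :=
      Fintype.card_congr Matrix.of.symm
    rw [hcard]
    refine (one_sub_div_le_card_linearIndependent F h).trans ?_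
    refine Nat.cast_le.2 (card_le_card_of_injOn Matrix.of (fun b hb => ?_)
      Matrix.of.injective.injOn)
    have hb' : LinearIndependent F (Matrix.of b).row := (mem_filter.1 hb).2
    refine mem_coe.2 (mem_filter.2 ⟨mem_univ _, ?_⟩)
    rw [card_image_of_injective _ (mul_right_injective_of_linearIndependent_row hb'), card_univ,
      card_matrix_fin]
  · rw [min_eq_left h]
    have hcard : Fintype.card (Matrix (Fin K) (Fin M) F) = Fintype.card (Fin M → Fin K → F) :=
      Fintype.card_congr ((Matrix.transposeAddEquiv _ _ _).toEquiv.trans Matrix.of.symm)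
    rw [hcard]
    refine (one_sub_div_le_card_linearIndependent F h).trans ?_
    refine Nat.cast_le.2 (card_le_card_of_injOn (fun b => (Matrix.of b).transpose)
      (fun b hb => ?_) (Matrix.transpose_injective.comp Matrix.of.injective).injOn)
    have hb' : LinearIndependent F (Matrix.of b).transpose.col := (mem_filter.1 hb).2
    refine mem_coe.2 (mem_filter.2 ⟨mem_univ _, ?_⟩)
    rw [image_univ_of_surjective (mul_right_surjective_of_linearIndependent_col hb'), card_univ,
      card_matrix_fin]

open Finset in
theorem card_image_mul_right_le (F : Type) [Field F] [Fintype F] (L K M : ℕ)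
    (b : Matrix (Fin K) (Fin M) F) :
    #(univ.image fun a : Matrix (Fin L) (Fin K) F => a * b) ≤
      Fintype.card F ^ (L * min M K) := by
  rcases le_total K M with h | h
  · rw [min_eq_right h]
    exact card_image_le.trans_eq (by rw [card_univ, card_matrix_fin])
  · rw [min_eq_left h]
    exact (card_le_univ _).trans_eq (card_matrix_fin F L M)

namespace SDMM

open Finset in
/-- `H(AB | B)` is the average over `b` of the log-size of the range of `a ↦ a * b`. -/
theorem Hc_mul_eq_average_log_card_image {F : Type} [Field F] [Fintype F] {L K M : ℕ}
    {Ω : Type} [Fintype Ω] {p : Ω → ℝ} {A : Ω → Matrix (Fin L) (Fin K) F}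
    {B : Ω → Matrix (Fin K) (Fin M) F} (hA : Uniform p A) (hB : Uniform p B)
    (hAB : IndepRV p A B) :
    Hc p (fun ω => A ω * B ω) B =
      (∑ b : Matrix (Fin K) (Fin M) F,
        Real.log #(univ.image fun a : Matrix (Fin L) (Fin K) F => a * b)) /
          Fintype.card (Matrix (Fin K) (Fin M) F) := by
  set N := Fintype.card (Matrix (Fin L) (Fin K) F)
  set R := Fintype.card (Matrix (Fin K) (Fin M) F)
  have hN : (N : ℝ) ≠ 0 := by exact_mod_cast Fintype.card_ne_zero
  have hdist : ∀ C b, distOf p (fun ω => (A ω * B ω, B ω)) (C, b) =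
      (#{a : Matrix (Fin L) (Fin K) F | a * b = C} : ℝ) / N * (1 / R) := by
    intro C b
    have hsum : distOf p (fun ω => (A ω * B ω, B ω)) (C, b) =
        ∑ a with a * b = C, distOf p (fun ω => (A ω, B ω)) (a, b) := by
      simp only [distOf]
      rw [sum_comm]
      refine sum_congr rfl fun ω _ => ?_
      by_cases hb : B ω = b
      · subst hb
        simp [sum_ite_eq]
      · simp [hb]
    rw [hsum, sum_congr rfl fun a _ => by rw [hAB a b, hA a, hB b], sum_const, nsmul_eq_mul]
    ring
  have hsum : ∀ b : Matrix (Fin K) (Fin M) F,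
      ∑ C : Matrix (Fin L) (Fin M) F,
        (#{a : Matrix (Fin L) (Fin K) F | a * b = C} : ℝ) / N = 1 := by
    intro b
    rw [← sum_div, ← Nat.cast_sum, ← card_eq_sum_card_fiberwise (fun _ _ => mem_coe.2 (mem_univ _)),
      card_univ, div_self hN]
  have hfiber : ∀ b : Matrix (Fin K) (Fin M) F,
      ∑ C : Matrix (Fin L) (Fin M) F,
        Real.negMulLog ((#{a : Matrix (Fin L) (Fin K) F | a * b = C} : ℝ) / N) =
      Real.log #(univ.image fun a : Matrix (Fin L) (Fin K) F => a * b) := by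
    intro b
    convert sum_negMulLog_card_fiber
      (AddMonoidHom.mk' (fun a : Matrix (Fin L) (Fin K) F => a * b)
        fun x y => Matrix.add_mul x y b) <;> rfl
  simp only [Hc, H]
  rw [Fintype.sum_prod_type_right, ← sum_sub_distrib, sum_div]
  refine sum_congr rfl fun b _ => ?_
  simp only [hdist, Real.negMulLog_mul, sum_add_distrib]
  rw [← mul_sum, ← sum_mul, hsum, hfiber, hB b]
  ring

end SDMM

/-- **Conditional entropy `H(AB | B)` (Lemma 2, eq. (16)).**
For fixed positive `L, K, M` and any `ε > 0`, for all sufficiently large finite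
fields `F` (`|F| = q`): if `A`, `B` are independent, uniformly distributed random
matrices over `F^{L×K}` and `F^{K×M}`, then `H(AB | B)` in `q`-ary units is within
`ε` of `min(L·M, L·K)`. -/
theorem cond_entropy_matrix_product_given_right
    (L K M : ℕ) (hL : 0 < L) (hK : 0 < K) (hM : 0 < M)
    (ε : ℝ) (hε : 0 < ε) :
    ∃ q₀ : ℕ, ∀ (F : Type) [Field F] [Fintype F], q₀ ≤ Fintype.card F →
      ∀ (Ω : Type) [Fintype Ω] (p : Ω → ℝ), SDMM.IsPMF p →
        ∀ (A : Ω → Matrix (Fin L) (Fin K) F) (B : Ω → Matrix (Fin K) (Fin M) F),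
          SDMM.Uniform p A → SDMM.Uniform p B → SDMM.IndepRV p A B →
          |SDMM.Hc p (fun ω => A ω * B ω) B / Real.log (Fintype.card F) -
            (min (L * M) (L * K) : ℝ)| < ε := by
  have hr : (min (L * M) (L * K) : ℝ) = L * (min M K : ℕ) := by
    rw [Nat.cast_min, mul_min_of_nonneg _ _ (Nat.cast_nonneg L)]
  rw [hr]
  set m := min M K
  obtain ⟨n, hn⟩ := exists_nat_gt ((L * m * m : ℝ) / ε)
  refine ⟨n, fun F _ _ hq Ω _ p _ A B hA hB hAB => ?_⟩
  rw [SDMM.Hc_mul_eq_average_log_card_image hA hB hAB]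
  have hfull := one_sub_div_le_card_full_range F L K M
  have himage := card_image_mul_right_le F L K M
  set q := Fintype.card F
  set R := Fintype.card (Matrix (Fin K) (Fin M) F)
  set r : Matrix (Fin K) (Fin M) F → ℕ :=
    fun b => (Finset.univ.image fun a : Matrix (Fin L) (Fin K) F => a * b).card
  change |(∑ b, Real.log (r b)) / (R : ℝ) / Real.log q - _| < ε
  have hq1 : (1 : ℝ) < q := by exact_mod_cast Fintype.one_lt_card
  have hlog : 0 < Real.log q := Real.log_pos hq1
  have hR : (0 : ℝ) < R := by exact_mod_cast Fintype.card_pos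
  have hlogpow : Real.log ((q ^ (L * m) : ℕ) : ℝ) = L * m * Real.log q := by
    rw [Nat.cast_pow, Real.log_pow, Nat.cast_mul]
  have hupper : ∑ b, Real.log (r b) ≤ R * (L * m * Real.log q) := by
    have h : ∀ b ∈ Finset.univ, Real.log (r b) ≤ L * m * Real.log q := fun b _ => by
      rw [← hlogpow]
      refine Real.log_le_log ?_ (Nat.cast_le.2 (himage b))
      exact Nat.cast_pos.2 (Finset.card_pos.2 (Finset.univ_nonempty.image _))
    simpa [R] using Finset.sum_le_card_nsmul _ _ _ h
  have hlower : (1 - m / q) * R * (L * m * Real.log q) ≤ ∑ b, Real.log (r b) := by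
    refine (mul_le_mul_of_nonneg_right hfull (by positivity)).trans ?_
    rw [← nsmul_eq_mul, ← Finset.sum_const]
    calc _ = ∑ b with r b = q ^ (L * m), Real.log (r b) :=
          Finset.sum_congr rfl fun b hb => by rw [(Finset.mem_filter.1 hb).2, hlogpow]
      _ ≤ _ := Finset.sum_le_sum_of_subset_of_nonneg (Finset.subset_univ _)
          fun b _ _ => Real.log_natCast_nonneg _
  have hub : (∑ b, Real.log (r b)) / R / Real.log q ≤ L * m := by
    rw [div_div, div_le_iff₀ (by positivity)]
    linarith
  have hlb : (1 - m / q) * (L * m) ≤ (∑ b, Real.log (r b)) / R / Real.log q := by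
    rw [div_div, le_div_iff₀ (by positivity)]
    linarith
  have herr : (L * m * m : ℝ) / q < ε := by
    have hnq : (n : ℝ) ≤ q := by exact_mod_cast hq
    rw [div_lt_iff₀ (by linarith), mul_comm ε, ← div_lt_iff₀ hε]
    exact hn.trans_le hnq
  have hexp : (1 - m / q : ℝ) * (L * m) = L * m - L * m * m / q := by ring
  rw [abs_lt]
  constructor <;> linarith
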